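/- (Process-set form of the GRPO loss, Equation 10.) Letting t_max = max_{1≤i≤k} len(g_i): ∑_{i=1}^k ∑_{t=0}^{len(g_i)−1} (P_{i,t}·a_i − D_{i,t}) = ∑_{t=0}^{t_max−1} ∑_{λ∈X_t} |λ|·(F(p_{λ,t})·Â(λ) − H(p_{λ,t})), where p_{λ,t} denotes the common prefix g_i.take(t+1) shared by all i ∈ λ (well-defined for λ ∈ X_t). In particular each process set's contribution to the GRPO loss at token index t is scaled by its cardinality |λ|. -/

import Mathlib

/-- `nodeG g p` is the set of indices `i` such that `p` is a prefix of the trajectory `g i`. -/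
noncomputable def nodeG {α : Type*} {k : ℕ} (g : Fin k → List α) (p : List α) :
    Finset (Fin k) :=
  @Finset.filter _ (fun i => p <+: g i) (Classical.decPred _) Finset.univ

/-- `BG g` is the family of process sets: nonempty sets of the form `nodeG g p`. -/
def BG {α : Type*} {k : ℕ} (g : Fin k → List α) : Set (Finset (Fin k)) :=
  {L | ∃ p : List α, (nodeG g p).Nonempty ∧ nodeG g p = L}

/-- `eG g L` is the length of the longest common prefix of the trajectories `g i`, `i ∈ L`. -/
noncomputable def eG {α : Type*} {k : ℕ} (g : Fin k → List α) (L : Finset (Fin k)) : ℕ :=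
  sSup {n : ℕ | ∃ p : List α, p.length = n ∧ ∀ i ∈ L, p <+: g i}

-- The immediate parent of a process set: its least strict superset in `BG g`.
open Classical in
noncomputable def parentG {α : Type*} {k : ℕ} (g : Fin k → List α) (L : Finset (Fin k)) :
    Finset (Fin k) :=
  if h : ∃ M, M ∈ BG g ∧ L ⊂ M ∧ ∀ M' ∈ BG g, L ⊂ M' → M ⊆ M' then h.choose
  else Finset.univ

/-- Start index of the process step of `L`: `0` for the root, `eG g (parentG g L)` otherwise. -/
noncomputable def sG {α : Type*} {k : ℕ} (g : Fin k → List α) (L : Finset (Fin k)) : ℕ :=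
  if L = Finset.univ then 0 else eG g (parentG g L)

/-- `XtG g t` is the family of process sets whose token span contains the index `t`. -/
noncomputable def XtG {α : Type*} {k : ℕ} (g : Fin k → List α) (t : ℕ) :
    Finset (Finset (Fin k)) :=
  @Finset.filter _ (fun L => L ∈ BG g ∧ sG g L ≤ t ∧ t < eG g L)
    (Classical.decPred _) Finset.univ

/-- Mean of the rewards. -/
noncomputable def rmeanG {k : ℕ} (r : Fin k → ℝ) : ℝ := (∑ i, r i) / k

/-- Standard deviation of the rewards. -/
noncomputable def rstdG {k : ℕ} (r : Fin k → ℝ) : ℝ :=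
  Real.sqrt ((∑ i, (r i - rmeanG r) ^ 2) / k)

/-- Outcome-level advantage `a_i`. -/
noncomputable def advG {k : ℕ} (r : Fin k → ℝ) (i : Fin k) : ℝ :=
  (r i - rmeanG r) / rstdG r

/-- Step-level reward `R̂(λ)`. -/
noncomputable def RhatG {k : ℕ} (r : Fin k → ℝ) (L : Finset (Fin k)) : ℝ :=
  (∑ i ∈ L, r i) / L.card

/-- Step-level advantage `Â(λ)`. -/
noncomputable def AhatG {k : ℕ} (r : Fin k → ℝ) (L : Finset (Fin k)) : ℝ :=
  (RhatG r L - rmeanG r) / rstdG r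

theorem mem_nodeG {α : Type*} {k : ℕ} {g : Fin k → List α} {q : List α} {i : Fin k} :
    i ∈ nodeG g q ↔ q <+: g i := by
  simp [nodeG]

theorem mem_XtG {α : Type*} {k : ℕ} {g : Fin k → List α} {t : ℕ} {L : Finset (Fin k)} :
    L ∈ XtG g t ↔ L ∈ BG g ∧ sG g L ≤ t ∧ t < eG g L := by
  simp [XtG]

theorem nonempty_of_mem_BG {α : Type*} {k : ℕ} {g : Fin k → List α} {L : Finset (Fin k)}
    (hL : L ∈ BG g) : L.Nonempty := by
  obtain ⟨q, hq, rfl⟩ := hL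
  exact hq

theorem nodeG_anti {α : Type*} {k : ℕ} (g : Fin k → List α) {q q' : List α} (h : q <+: q') :
    nodeG g q' ⊆ nodeG g q := fun _ hi =>
  mem_nodeG.2 (h.trans (mem_nodeG.1 hi))

theorem univ_mem_BG {α : Type*} {k : ℕ} (g : Fin k → List α) (i : Fin k) :
    Finset.univ ∈ BG g :=
  ⟨[], ⟨i, mem_nodeG.2 List.nil_prefix⟩, by ext; simp [mem_nodeG]⟩

/-- Two process sets with a common element are comparable. -/
theorem subset_or_subset_of_mem_BG {α : Type*} {k : ℕ} {g : Fin k → List α}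
    {L M : Finset (Fin k)} (hL : L ∈ BG g) (hM : M ∈ BG g) {i : Fin k} (hiL : i ∈ L)
    (hiM : i ∈ M) : L ⊆ M ∨ M ⊆ L := by
  obtain ⟨q, -, rfl⟩ := hL
  obtain ⟨q', -, rfl⟩ := hM
  rcases List.prefix_or_prefix_of_prefix (mem_nodeG.1 hiL) (mem_nodeG.1 hiM) with h | h
  · exact Or.inr (nodeG_anti g h)
  · exact Or.inl (nodeG_anti g h)

theorem le_eG_iff {α : Type*} {k : ℕ} {g : Fin k → List α} {L : Finset (Fin k)} {i : Fin k}
    (hi : i ∈ L) {n : ℕ} :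
    n ≤ eG g L ↔ n ≤ (g i).length ∧ L ⊆ nodeG g ((g i).take n) := by
  have hbdd : BddAbove {n : ℕ | ∃ q : List α, q.length = n ∧ ∀ j ∈ L, q <+: g j} := by
    refine ⟨(g i).length, ?_⟩
    rintro _ ⟨q, rfl, hq⟩
    exact (hq i hi).length_le
  constructor
  · intro hn
    obtain ⟨q, hlen, hq⟩ : ∃ q : List α, q.length = eG g L ∧ ∀ j ∈ L, q <+: g j :=
      Nat.sSup_mem (s := {n : ℕ | ∃ q : List α, q.length = n ∧ ∀ j ∈ L, q <+: g j})
        ⟨0, [], rfl, fun _ _ => List.nil_prefix⟩ hbdd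
    have hqi := hq i hi
    refine ⟨hn.trans (hlen ▸ hqi.length_le), fun j hj => mem_nodeG.2 ?_⟩
    have htake : (g i).take n = q.take n := by
      rw [List.prefix_iff_eq_take.1 hqi, List.take_take, min_eq_left (hlen ▸ hn)]
    rw [htake]
    exact (List.take_prefix n q).trans (hq j hj)
  · rintro ⟨hn, hsub⟩
    exact le_csSup hbdd ⟨(g i).take n, by simpa using hn, fun j hj => mem_nodeG.1 (hsub hj)⟩

theorem parentG_spec {α : Type*} {k : ℕ} {g : Fin k → List α} {L : Finset (Fin k)}
    (hL : L ∈ BG g) (hne : L ≠ Finset.univ) :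
    parentG g L ∈ BG g ∧ L ⊂ parentG g L ∧ ∀ M ∈ BG g, L ⊂ M → parentG g L ⊆ M := by
  obtain ⟨i, hi⟩ := nonempty_of_mem_BG hL
  have h : ∃ M, M ∈ BG g ∧ L ⊂ M ∧ ∀ M' ∈ BG g, L ⊂ M' → M ⊆ M' := by
    obtain ⟨M, hM⟩ := (Set.toFinite {M | M ∈ BG g ∧ L ⊂ M}).exists_minimal
      ⟨Finset.univ, univ_mem_BG g i, Finset.ssubset_univ_iff.2 hne⟩
    refine ⟨M, hM.prop.1, hM.prop.2, fun M' hM' hLM' => ?_⟩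
    rcases subset_or_subset_of_mem_BG hM.prop.1 hM' (hM.prop.2.subset hi) (hLM'.subset hi)
      with h | h
    · exact h
    · exact hM.le_of_le ⟨hM', hLM'⟩ h
  rw [parentG, dif_pos h]
  exact h.choose_spec

/-- The process set active at token `t` of trajectory `i` is the node of its prefix of length
`t + 1`. -/
theorem mem_XtG_and_mem_iff {α : Type*} {k : ℕ} {g : Fin k → List α} {t : ℕ}
    {L : Finset (Fin k)} {i : Fin k} :
    L ∈ XtG g t ∧ i ∈ L ↔ t < (g i).length ∧ L = nodeG g ((g i).take (t + 1)) := by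
  have hi : i ∈ nodeG g ((g i).take (t + 1)) := mem_nodeG.2 (List.take_prefix _ _)
  have hnode : nodeG g ((g i).take (t + 1)) ∈ BG g := ⟨_, ⟨i, hi⟩, rfl⟩
  constructor
  · rintro ⟨hL, hiL⟩
    obtain ⟨hB, hs, he⟩ := mem_XtG.1 hL
    obtain ⟨hlt, hsub⟩ := (le_eG_iff hiL).1 (Nat.succ_le_of_lt he)
    refine ⟨hlt, by_contra fun hne => ?_⟩
    have hss := hsub.ssubset_of_ne hne
    have huniv : L ≠ Finset.univ := by
      rintro rfl
      exact hss.2 (Finset.subset_univ _)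
    obtain ⟨-, hLP, hleast⟩ := parentG_spec hB huniv
    rw [sG, if_neg huniv] at hs
    have : t + 1 ≤ eG g (parentG g L) :=
      (le_eG_iff (hLP.subset hiL)).2 ⟨hlt, hleast _ hnode hss⟩
    omega
  · rintro ⟨hlt, rfl⟩
    refine ⟨mem_XtG.2 ⟨hnode, ?_, (le_eG_iff hi).2 ⟨hlt, subset_rfl⟩⟩, hi⟩
    rw [sG]
    split_ifs with huniv
    · exact t.zero_le
    · obtain ⟨-, hLP, -⟩ := parentG_spec hnode huniv
      by_contra! h
      exact hLP.2 ((le_eG_iff (hLP.subset hi)).1 h).2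

theorem card_mul_AhatG {k : ℕ} (r : Fin k → ℝ) {L : Finset (Fin k)} (hL : L.Nonempty) :
    (L.card : ℝ) * AhatG r L = ∑ i ∈ L, advG r i := by
  have hc : (L.card : ℝ) ≠ 0 := by exact_mod_cast hL.card_pos.ne'
  simp only [AhatG, RhatG, advG]
  rw [← Finset.sum_div, Finset.sum_sub_distrib, Finset.sum_const, nsmul_eq_mul, ← mul_div_assoc,
    mul_sub, mul_div_cancel₀ _ hc]

/-- **Process-set form of the GRPO loss (Equation 10).** With `t_max = max_i len(gᵢ)` and
`p L t` the common prefix `gᵢ.take (t+1)` shared by all `i ∈ L` (well-defined for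
`L ∈ X_t`), the GRPO loss equals the sum over process sets of their contributions,
each scaled by the cardinality `|λ|`. -/
theorem grpo_loss_process_set_form {α : Type*} {k : ℕ} (hk : 1 ≤ k)
    (g : Fin k → List α) (r : Fin k → ℝ) (hstd : 0 < rstdG r)
    (F H : List α → ℝ)
    (p : Finset (Fin k) → ℕ → List α)
    (hp : ∀ t : ℕ, ∀ L ∈ XtG g t, ∀ i ∈ L, (g i).take (t + 1) = p L t) :
    ∑ i, ∑ t ∈ Finset.range (g i).length,
        (F ((g i).take (t + 1)) * advG r i - H ((g i).take (t + 1))) =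
      ∑ t ∈ Finset.range (Finset.univ.sup fun i => (g i).length),
        ∑ L ∈ XtG g t, (L.card : ℝ) * (F (p L t) * AhatG r L - H (p L t)) := by
  have hblock : ∀ t, ∀ L ∈ XtG g t,
      (L.card : ℝ) * (F (p L t) * AhatG r L - H (p L t)) =
        ∑ i ∈ L, (F ((g i).take (t + 1)) * advG r i - H ((g i).take (t + 1))) := by
    intro t L hL
    rw [Finset.sum_congr rfl fun i hi => by rw [hp t L hL i hi], Finset.sum_sub_distrib,
      ← Finset.mul_sum, ← card_mul_AhatG r (nonempty_of_mem_BG (mem_XtG.1 hL).1),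
      Finset.sum_const, nsmul_eq_mul]
    ring
  rw [Finset.sum_comm' (t' := Finset.range (Finset.univ.sup fun i => (g i).length))
    (s' := fun t => Finset.univ.filter fun i => t < (g i).length)]
  · refine Finset.sum_congr rfl fun t _ => ?_
    rw [Finset.sum_congr rfl (hblock t),
      Finset.sum_comm' (t' := Finset.univ.filter fun i => t < (g i).length)
        (s' := fun i => {nodeG g ((g i).take (t + 1))})]
    · simp
    · intro L i
      rw [mem_XtG_and_mem_iff]
      simp [and_comm]
  · intro i t
    simp only [Finset.mem_univ, Finset.mem_range, Finset.mem_filter, true_and]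
    exact ⟨fun h => ⟨h, h.trans_le (Finset.le_sup (f := fun i => (g i).length)
      (Finset.mem_univ i))⟩, And.left⟩
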